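/- If π is a strongly Rayleigh probability distribution on the subsets of [N], then its symmetric homogenization π_sh is a strongly Rayleigh probability distribution on the subsets of [2N]. -/

import Mathlib

open Finset
open scoped Classical

/-- The intersection `T ∩ [N]` of a subset `T ⊆ [2N]` with `[N]`, viewed as a subset
of `[N]`. -/
def restrictDown (N : ℕ) (T : Finset (Fin (2 * N))) : Finset (Fin N) :=
  Finset.univ.filter fun i : Fin N => Fin.castLE (by omega) i ∈ T

/-- The symmetric homogenization `π_sh` of a distribution `π` on subsets of `[N]`:
`π_sh(T) = π(T∩[N]) · binom(N, |T∩[N]|)⁻¹` if `|T| = N`, and `0` otherwise. -/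
noncomputable def symmHom (N : ℕ) (π : Finset (Fin N) → ℝ)
    (T : Finset (Fin (2 * N))) : ℝ :=
  if T.card = N then π (restrictDown N T) / (N.choose (restrictDown N T).card : ℝ) else 0

/-- The generating polynomial of `π`, as a function of complex arguments. -/
noncomputable def genPoly {M : ℕ} (π : Finset (Fin M) → ℝ) (z : Fin M → ℂ) : ℂ :=
  ∑ S : Finset (Fin M), (π S : ℂ) * ∏ i ∈ S, z i

/-- A distribution on subsets of `[M]` is strongly Rayleigh if its generating polynomial
is real stable. -/
def StronglyRayleigh {M : ℕ} (π : Finset (Fin M) → ℝ) : Prop :=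
  ∀ z : Fin M → ℂ, (∀ i, 0 < (z i).im) → genPoly π z ≠ 0

/-- A probability distribution on subsets of `[M]`. -/
def IsProbDist {M : ℕ} (π : Finset (Fin M) → ℝ) : Prop :=
  (∀ S, 0 ≤ π S) ∧ ∑ S : Finset (Fin M), π S = 1


/-- Points of the disc, added up. -/
lemma disc_sum (c : ℂ) (R : Multiset ℂ) (h : ∀ v ∈ R, ‖v + c‖ ≤ ‖c‖) :
    ‖R.sum + R.card * c‖ ≤ R.card * ‖c‖ := by
  induction R using Multiset.induction_on with
  | empty => simp
  | cons a s ih =>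
    have h1 := ih (fun v hv => h v (Multiset.mem_cons_of_mem hv))
    have h2 := h a (Multiset.mem_cons_self a s)
    rw [Multiset.sum_cons, Multiset.card_cons]
    push_cast
    calc ‖a + s.sum + ((s.card : ℂ) + 1) * c‖ = ‖(a + c) + (s.sum + s.card * c)‖ := by ring_nf
      _ ≤ ‖a + c‖ + ‖s.sum + s.card * c‖ := norm_add_le _ _
      _ ≤ _ := by linarith

/-- Membership in the disc `|v + i/(2y)| ≤ 1/(2y)`. -/
lemma disc_iff (y : ℝ) (hy : 0 < y) (m : ℝ) (hm : 0 ≤ m) (v : ℂ) :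
    ‖v + m * (Complex.I / (2 * y))‖ ≤ m * ‖(Complex.I / (2 * y) : ℂ)‖ ↔
      y * (v.re ^ 2 + v.im ^ 2) + m * v.im ≤ 0 := by
  have e : ∀ t : ℝ, ((t : ℂ) * (Complex.I / (2 * y))) = Complex.I * ((t / (2 * y) : ℝ) : ℂ) := by
    intro t; push_cast; ring
  have e1 : m * ‖(Complex.I / (2 * y) : ℂ)‖ = m / (2 * y) := by
    simp [abs_of_pos hy]; field_simp
  have hp : 0 ≤ m / (2 * y) := by positivity
  have er : (v + Complex.I * ((m / (2 * y) : ℝ) : ℂ)).re = v.re := by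
    rw [Complex.add_re, Complex.I_mul_re, Complex.ofReal_im]; simp
  have ei : (v + Complex.I * ((m / (2 * y) : ℝ) : ℂ)).im = v.im + m / (2 * y) := by
    rw [Complex.add_im, Complex.I_mul_im, Complex.ofReal_re]
  rw [e1, e, ← abs_of_nonneg hp, ← abs_of_nonneg (norm_nonneg (v + _)), ← sq_le_sq,
    abs_of_nonneg hp, ← Complex.normSq_eq_norm_sq, Complex.normSq_apply, er, ei]
  have : v.re * v.re + (v.im + m / (2 * y)) * (v.im + m / (2 * y)) - (m / (2*y))^2
     = (y * (v.re ^ 2 + v.im ^ 2) + m * v.im) / y := by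
    field_simp; ring
  constructor
  · intro h
    have h3 : (y * (v.re ^ 2 + v.im ^ 2) + m * v.im) / y ≤ 0 := by linarith
    by_contra hc
    have := div_pos (not_le.mp hc) hy
    linarith
  · intro h
    have := div_nonpos_of_nonpos_of_nonneg h hy.le
    linarith

/-- Laguerre's lemma for the upper half-plane. -/
lemma laguerre (q : Polynomial ℂ) (n : ℕ) (hn : 0 < n) (hd : q.natDegree ≤ n)
    (hq : ∀ w : ℂ, 0 < w.im → q.eval w ≠ 0) (a w : ℂ) (ha : 0 < a.im) (hw : 0 < w.im) :
    q.eval w + (a - w) * q.derivative.eval w / n ≠ 0 := by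
  intro h0
  have hqw := hq w hw
  have hnc : (n : ℂ) ≠ 0 := by exact_mod_cast hn.ne'
  have hnr : (0 : ℝ) < n := by exact_mod_cast hn
  set v := q.derivative.eval w / q.eval w with hv
  have hv1 : v = (q.roots.map fun z => 1 / (w - z)).sum := by
    rw [hv, (IsAlgClosed.splits q).eval_derivative_div_eval_of_ne_zero hqw]
  have hv2 : (w - a) * v = n := by
    rw [hv]; field_simp; field_simp at h0; linear_combination -h0
  have hwa : w - a ≠ 0 := by
    intro h; rw [h, zero_mul] at hv2; exact hnc hv2.symm
  have key : ‖v + (n : ℝ) * (Complex.I / (2 * (w.im : ℝ)))‖ ≤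
      (n : ℝ) * ‖(Complex.I / (2 * (w.im : ℝ)) : ℂ)‖ := by
    have hds := disc_sum (Complex.I / (2 * (w.im : ℝ))) (q.roots.map fun z => 1 / (w - z)) (by
      intro u hu
      obtain ⟨r, hr, rfl⟩ := Multiset.mem_map.mp hu
      have hr1 : r.im ≤ 0 := by
        by_contra hc
        exact hq r (not_le.mp hc) (Polynomial.isRoot_of_mem_roots hr)
      have := (disc_iff w.im hw 1 zero_le_one (1 / (w - r))).mpr (by
        have hns : 0 < Complex.normSq (w - r) := by
          rw [Complex.normSq_pos]; intro h
          have := congrArg Complex.im h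
          simp at this; linarith
        have e1 : (1 / (w - r)).re ^ 2 + (1 / (w - r)).im ^ 2 = 1 / Complex.normSq (w - r) := by
          rw [one_div (w - r), one_div (Complex.normSq (w - r)), ← map_inv₀ Complex.normSq, Complex.normSq_apply]; ring
        have e2 : (1 / (w - r)).im = - (w.im - r.im) / Complex.normSq (w - r) := by
          simp [Complex.inv_im]
        rw [e1, e2]
        have : w.im * (1 / Complex.normSq (w - r)) + 1 * (-(w.im - r.im) / Complex.normSq (w - r))
          = r.im / Complex.normSq (w - r) := by ring
        rw [this]
        exact div_nonpos_of_nonpos_of_nonneg hr1 hns.le)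
      simpa using this)
    rw [← hv1, Multiset.card_map] at hds
    have hc : q.roots.card ≤ n := (Polynomial.card_roots' q).trans hd
    set c : ℂ := Complex.I / (2 * (w.im : ℝ))
    set d := q.roots.card
    have hc' : (d : ℝ) ≤ n := by exact_mod_cast hc
    calc ‖v + (n : ℝ) * c‖ = ‖(v + d * c) + ((n - d : ℝ) : ℂ) * c‖ := by
          congr 1; push_cast; ring
      _ ≤ ‖v + d * c‖ + ‖((n - d : ℝ) : ℂ) * c‖ := norm_add_le _ _
      _ = ‖v + d * c‖ + (n - d) * ‖c‖ := by
          rw [norm_mul, Complex.norm_real, Real.norm_of_nonneg (by linarith)]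
      _ ≤ _ := by linarith
  rw [disc_iff w.im hw n hnr.le] at key
  have hve : v = n * (w - a)⁻¹ := by field_simp; linear_combination hv2
  have hns : 0 < Complex.normSq (w - a) := Complex.normSq_pos.mpr hwa
  have e1 : v.re ^ 2 + v.im ^ 2 = n ^ 2 / Complex.normSq (w - a) := by
    have : v.re ^ 2 + v.im ^ 2 = Complex.normSq v := by rw [Complex.normSq_apply]; ring
    rw [this, hve, Complex.normSq_mul, Complex.normSq_inv, Complex.normSq_natCast]
    ring
  have e2 : v.im = - n * (w.im - a.im) / Complex.normSq (w - a) := by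
    rw [hve]; simp [Complex.inv_im]; ring
  rw [e1, e2] at key
  have : w.im * ((n:ℝ) ^ 2 / Complex.normSq (w - a)) + n * (- n * (w.im - a.im) / Complex.normSq (w - a))
     = n ^ 2 * a.im / Complex.normSq (w - a) := by ring
  rw [this] at key
  have : 0 < (n:ℝ) ^ 2 * a.im / Complex.normSq (w - a) := by positivity
  linarith

lemma esymm_cons_succ (a : ℂ) (s : Multiset ℂ) (k : ℕ) :
    (a ::ₘ s).esymm (k + 1) = s.esymm (k + 1) + a * s.esymm k := by
  simp [Multiset.esymm, Multiset.powersetCard_cons, Multiset.map_map,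
    Multiset.sum_map_mul_left]

/-- The polarization of `q` in `card s` variables, evaluated at `s`. -/
noncomputable def polar (q : Polynomial ℂ) (s : Multiset ℂ) : ℂ :=
  ∑ k ∈ range (s.card + 1), q.coeff k * s.esymm k / (s.card.choose k : ℂ)

/-- The polar derivative. -/
noncomputable def polarD (a : ℂ) (n : ℕ) (q : Polynomial ℂ) : Polynomial ℂ :=
  q + (Polynomial.C a - Polynomial.X) * q.derivative * Polynomial.C ((n : ℂ)⁻¹)

lemma polarD_coeff (a : ℂ) (n : ℕ) (hn : 0 < n) (q : Polynomial ℂ) (k : ℕ) :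
    (polarD a n q).coeff k = (n - k) / n * q.coeff k + a * (k + 1) / n * q.coeff (k + 1) := by
  have hnc : (n : ℂ) ≠ 0 := by exact_mod_cast hn.ne'
  rw [polarD, Polynomial.coeff_add, Polynomial.coeff_mul_C, sub_mul, Polynomial.coeff_sub,
    Polynomial.coeff_C_mul, Polynomial.coeff_derivative]
  cases k with
  | zero => simp; field_simp
  | succ k =>
    rw [Polynomial.coeff_X_mul, Polynomial.coeff_derivative]
    push_cast; field_simp; ring

lemma polar_cons (q : Polynomial ℂ) (a : ℂ) (s : Multiset ℂ) :
    polar q (a ::ₘ s) = polar (polarD a (s.card + 1) q) s := by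
  set m := s.card with hm
  have hesz : s.esymm (m + 1) = 0 := by
    simp [Multiset.esymm, Multiset.powersetCard_eq_empty (m+1) (show s.card < m + 1 by omega)]
  have h1 : polar q (a ::ₘ s) = ∑ k ∈ range (m + 1), q.coeff k * s.esymm k / ((m+1).choose k : ℂ)
      + ∑ k ∈ range (m + 1), q.coeff (k+1) * (a * s.esymm k) / ((m+1).choose (k+1) : ℂ) := by
    have h2 : ∑ k ∈ range (m + 1), q.coeff k * s.esymm k / ((m+1).choose k : ℂ)
      = ∑ k ∈ range (m + 1 + 1), q.coeff k * s.esymm k / ((m+1).choose k : ℂ) := by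
      rw [Finset.sum_range_succ _ (m+1), hesz]; simp
    rw [h2, polar, Multiset.card_cons, ← hm, Finset.sum_range_succ', Finset.sum_range_succ' _ (m+1)]
    rw [add_right_comm, ← Finset.sum_add_distrib]
    congr 1
    · refine Finset.sum_congr rfl fun k _ => ?_
      rw [esymm_cons_succ]; ring
    · simp [Multiset.esymm]
  rw [h1, polar, ← hm, ← Finset.sum_add_distrib]
  refine Finset.sum_congr rfl fun k hk => ?_
  have hk' : k ≤ m := by simpa [Nat.lt_succ_iff] using hk
  rw [polarD_coeff _ _ (Nat.succ_pos m)]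
  have c1 : (m.choose k : ℂ) ≠ 0 := by exact_mod_cast (Nat.choose_pos hk').ne'
  have c2 : ((m+1).choose k : ℂ) ≠ 0 := by
    exact_mod_cast (Nat.choose_pos (show k ≤ m + 1 by omega)).ne'
  have c3 : ((m+1).choose (k+1) : ℂ) ≠ 0 := by
    exact_mod_cast (Nat.choose_pos (show k + 1 ≤ m + 1 by omega)).ne'
  have c4 : ((m + 1 : ℕ) : ℂ) ≠ 0 := by exact_mod_cast (Nat.succ_ne_zero m)
  have r1 : ((m:ℂ) + 1) * m.choose k = (m+1).choose (k+1) * (k+1) := by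
    exact_mod_cast Nat.add_one_mul_choose_eq m k
  have r2 : ((m:ℂ) + 1) * m.choose k = (m+1).choose k * (m + 1 - k) := by
    have h := Nat.choose_mul_succ_eq m k
    have : ((m + 1 - k : ℕ) : ℂ) = m + 1 - k := by
      rw [Nat.cast_sub (by omega)]; push_cast; ring
    rw [← this, mul_comm]; exact_mod_cast h
  have c5 : ((m:ℂ) + 1) ≠ 0 := by exact_mod_cast c4
  have g1 : (((m + 1 : ℕ) : ℂ) - k) / ((m + 1 : ℕ) : ℂ) / m.choose k = 1 / ((m+1).choose k : ℂ) := by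
    push_cast; field_simp; linear_combination -r2
  have g2 : ((k : ℂ) + 1) / ((m + 1 : ℕ) : ℂ) / m.choose k = 1 / ((m+1).choose (k+1) : ℂ) := by
    push_cast; field_simp; linear_combination -r1
  linear_combination (-q.coeff k * s.esymm k) * g1 - q.coeff (k+1) * a * s.esymm k * g2

/-- Grace–Walsh–Szegő for the upper half-plane. -/
lemma gws (s : Multiset ℂ) : ∀ q : Polynomial ℂ, (∀ a ∈ s, 0 < a.im) → q.natDegree ≤ s.card →
    (∀ w : ℂ, 0 < w.im → q.eval w ≠ 0) → polar q s ≠ 0 := by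
  induction s using Multiset.induction_on with
  | empty =>
    intro q _ hd hq
    have := hq Complex.I (by simp)
    rw [Polynomial.eq_C_of_natDegree_le_zero hd] at this
    simpa [polar, Multiset.esymm] using this
  | cons a s ih =>
    intro q ha hd hq
    rw [polar_cons]
    rw [Multiset.card_cons] at hd
    refine ih _ (fun b hb => ha b (Multiset.mem_cons_of_mem hb)) ?_ ?_
    · rw [Polynomial.natDegree_le_iff_coeff_eq_zero]
      intro k hk
      rw [polarD_coeff _ _ (Nat.succ_pos _)]
      have h1 : q.coeff (k+1) = 0 := Polynomial.coeff_eq_zero_of_natDegree_lt (by omega)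
      rw [h1]
      rcases Nat.lt_or_ge (s.card + 1) k with h | h
      · rw [Polynomial.coeff_eq_zero_of_natDegree_lt (show q.natDegree < k by omega)]; simp
      · have : k = s.card + 1 := by omega
        rw [this]; simp
    · intro w hw
      have := laguerre q (s.card + 1) (Nat.succ_pos _) hd hq a w (ha a (Multiset.mem_cons_self a s)) hw
      simpa [polarD, div_eq_mul_inv] using this

/-- Zero-freeness in a disc is preserved along a homotopy without boundary zeros. -/
lemma disc_homotopy (F : ℝ → ℂ → ℂ) (hF : Continuous fun x : ℝ × ℂ => F x.1 x.2)
    (hd : ∀ t, Differentiable ℂ (F t))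
    (hb : ∀ t ∈ Set.Icc (0:ℝ) 1, ∀ ξ : ℂ, ‖ξ‖ = 1 → F t ξ ≠ 0)
    (h0 : ∀ ξ : ℂ, ‖ξ‖ ≤ 1 → F 0 ξ ≠ 0) :
    ∀ ξ : ℂ, ‖ξ‖ ≤ 1 → F 1 ξ ≠ 0 := by
  -- uniform lower bound on the boundary
  have hK : IsCompact (Set.Icc (0:ℝ) 1 ×ˢ Metric.sphere (0:ℂ) 1) :=
    isCompact_Icc.prod (isCompact_sphere 0 1)
  obtain ⟨x0, hx0, hmin⟩ := hK.exists_isMinOn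
    ⟨((0:ℝ), (1:ℂ)), by simp⟩ (f := fun x : ℝ × ℂ => ‖F x.1 x.2‖) hF.norm.continuousOn
  set m := ‖F x0.1 x0.2‖ with hm
  have hmpos : 0 < m := norm_pos_iff.mpr (hb _ hx0.1 _ (by simpa using hx0.2))
  have hmb : ∀ t ∈ Set.Icc (0:ℝ) 1, ∀ ξ : ℂ, ‖ξ‖ = 1 → m ≤ ‖F t ξ‖ := by
    intro t ht ξ hξ
    exact hmin (show (t, ξ) ∈ _ from ⟨ht, by simpa using hξ⟩)
  -- the good set
  let G : Set ℝ := {t | ∀ ξ : ℂ, ‖ξ‖ ≤ 1 → F t ξ ≠ 0}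
  have hG : ∀ t ∈ Set.Icc (0:ℝ) 1, t ∈ G → ∀ ξ : ℂ, ‖ξ‖ ≤ 1 → m ≤ ‖F t ξ‖ := by
    intro t ht hg ξ hξ
    have hcl : closure (Metric.ball (0:ℂ) 1) = Metric.closedBall 0 1 :=
      closure_ball 0 one_ne_zero
    have hdc : DiffContOnCl ℂ (fun z => (F t z)⁻¹) (Metric.ball (0:ℂ) 1) := by
      apply DiffContOnCl.inv (hd t).diffContOnCl
      intro z hz
      rw [hcl] at hz
      exact hg z (by simpa using hz)
    have := Complex.norm_le_of_forall_mem_frontier_norm_le (C := m⁻¹) Metric.isBounded_ball hdc (by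
      intro z hz
      rw [frontier_ball (0:ℂ) one_ne_zero] at hz
      rw [norm_inv]
      exact inv_anti₀ hmpos (hmb t ht z (by simpa using hz))) (z := ξ)
      (by rw [hcl]; simpa using hξ)
    rw [norm_inv] at this
    exact (inv_le_inv₀ (norm_pos_iff.mpr (hg ξ hξ)) hmpos).mp this
  let G1 : Set ℝ := {t | ∀ ξ : ℂ, ‖ξ‖ ≤ 1 → m ≤ ‖F t ξ‖}
  have hG1 : IsClosed G1 := by
    have : G1 = ⋂ ξ : ℂ, ⋂ _ : ‖ξ‖ ≤ 1, {t | m ≤ ‖F t ξ‖} := by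
      ext t; simp [G1]
    rw [this]
    refine isClosed_iInter fun ξ => isClosed_iInter fun _ => ?_
    refine isClosed_le continuous_const ?_
    exact (hF.comp (Continuous.prodMk continuous_id continuous_const)).norm
  let B : Set ℝ := Prod.fst '' ((Set.Icc (0:ℝ) 1 ×ˢ Metric.closedBall (0:ℂ) 1) ∩
    {x : ℝ × ℂ | F x.1 x.2 = 0})
  have hB : IsClosed B := by
    apply IsCompact.isClosed
    apply IsCompact.image _ continuous_fst
    exact (isCompact_Icc.prod (isCompact_closedBall 0 1)).inter_right
      (isClosed_eq hF continuous_const)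
  have hcover : Set.Icc (0:ℝ) 1 ⊆ G1 ∪ B := by
    intro t ht
    by_cases hg : t ∈ G
    · exact Or.inl (hG t ht hg)
    · right
      simp only [G, Set.mem_ofPred_eq, not_forall, not_not] at hg
      obtain ⟨ξ, hξ, hz⟩ := hg
      exact ⟨(t, ξ), ⟨⟨ht, by simpa using hξ⟩, hz⟩, rfl⟩
  intro ξ hξ hz
  have hpre : IsPreconnected (Set.Icc (0:ℝ) 1) := isPreconnected_Icc
  rw [isPreconnected_closed_iff] at hpre
  obtain ⟨t, ht, h1, h2⟩ := hpre G1 B hG1 hB hcover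
    ⟨0, by simp, hG 0 (by simp) h0⟩
    ⟨1, by simp, ⟨(1, ξ), ⟨⟨by simp, by simpa using hξ⟩, hz⟩, rfl⟩⟩
  obtain ⟨⟨t', ξ'⟩, ⟨⟨_, hb'⟩, hz'⟩, rfl⟩ := h2
  have := h1 ξ' (by simpa using hb')
  simp only [Set.mem_ofPred_eq] at hz'
  rw [hz', norm_zero] at this
  linarith

lemma genPoly_conj {N : ℕ} (π : Finset (Fin N) → ℝ) (z : Fin N → ℂ) :
    genPoly π (fun i => (starRingEnd ℂ) (z i)) = (starRingEnd ℂ) (genPoly π z) := by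
  simp [genPoly, map_sum, map_prod]

lemma genPoly_ne_of_neg {N : ℕ} (π : Finset (Fin N) → ℝ) (hSR : StronglyRayleigh π)
    (z : Fin N → ℂ) (hz : ∀ i, (z i).im < 0) : genPoly π z ≠ 0 := by
  intro h
  refine hSR (fun i => (starRingEnd ℂ) (z i)) (fun i => by simpa using hz i) ?_
  rw [genPoly_conj, h, map_zero]

lemma pos_sum {N : ℕ} (π : Finset (Fin N) → ℝ) (hπ : IsProbDist π) (c : Finset (Fin N) → ℝ)
    (hc : ∀ S, 0 < c S) : 0 < ∑ S, π S * c S := by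
  have h1 : ∀ S ∈ (univ : Finset (Finset (Fin N))), 0 ≤ π S * c S :=
    fun S _ => mul_nonneg (hπ.1 S) (hc S).le
  refine lt_of_le_of_ne (Finset.sum_nonneg h1) (fun h => ?_)
  have h2 := (Finset.sum_eq_zero_iff_of_nonneg h1).mp h.symm
  have h3 : ∑ S, π S = 0 := Finset.sum_eq_zero fun S hS => by
    rcases mul_eq_zero.mp (h2 S hS) with h | h
    · exact h
    · exact absurd h (hc S).ne'
  rw [hπ.2] at h3
  exact one_ne_zero h3

/-- The generating polynomial in homogeneous coordinates `x i / y i`. -/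
noncomputable def bih {N : ℕ} (π : Finset (Fin N) → ℝ) (x y : Fin N → ℂ) : ℂ :=
  ∑ S : Finset (Fin N), (π S : ℂ) * ((∏ i ∈ S, x i) * ∏ i ∈ Sᶜ, y i)

lemma bih_eq {N : ℕ} (π : Finset (Fin N) → ℝ) (x y : Fin N → ℂ) (hy : ∀ i, y i ≠ 0) :
    bih π x y = (∏ i, y i) * genPoly π (fun i => x i / y i) := by
  rw [bih, genPoly, Finset.mul_sum]
  refine Finset.sum_congr rfl fun S _ => ?_
  rw [Finset.prod_div_distrib, ← Finset.prod_mul_prod_compl S y]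
  have : ∏ i ∈ S, y i ≠ 0 := Finset.prod_ne_zero_iff.mpr fun i _ => hy i
  field_simp

lemma bih_const_ne {N : ℕ} (π : Finset (Fin N) → ℝ) (hπ : IsProbDist π) (u : Fin N → ℂ)
    (hu : ∀ i, u i ≠ 0) (a b : ℝ) (ha : 0 < a) (hb : 0 < b) :
    bih π (fun i => a * u i) (fun i => b * u i) ≠ 0 := by
  rw [bih_eq π _ _ (fun i => mul_ne_zero (by exact_mod_cast hb.ne') (hu i))]
  refine mul_ne_zero (Finset.prod_ne_zero_iff.mpr fun i _ =>
    mul_ne_zero (by exact_mod_cast hb.ne') (hu i)) ?_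
  have h1 : ∀ i, (a * u i) / (b * u i) = ((a / b : ℝ) : ℂ) := by
    intro i; have := hu i; push_cast; field_simp
  have h2 := pos_sum π hπ (fun S => ∏ i ∈ S, (a / b)) (fun S => Finset.prod_pos fun i _ => by positivity)
  have h3 : genPoly π (fun i => (a * u i) / (b * u i)) = ((∑ S, π S * ∏ i ∈ S, (a / b) : ℝ) : ℂ) := by
    simp only [h1, genPoly]; push_cast; rfl
  rw [h3]
  exact_mod_cast h2.ne'

lemma mob_im (δ : ℝ) (x : ℂ) (h : 1 + δ * x ≠ 0) :
    (x / (1 + δ * x)).im = x.im / Complex.normSq (1 + δ * x) := by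
  have := Complex.normSq_pos.mpr h
  rw [Complex.div_im]
  simp
  field_simp
  ring

/-- Real-stability with nonnegative coefficients: zero-freeness in rotated half-planes, after
regularization. -/
lemma rot_reg {N : ℕ} (π : Finset (Fin N) → ℝ) (hπ : IsProbDist π) (hSR : StronglyRayleigh π)
    (ε : ℝ) (hε : 0 < ε) (u : Fin N → ℂ) (hu : ∀ i, 0 < (u i).im) (w : ℂ) (hw : w.im < 0) :
    bih π (fun i => ε + w * u i) (fun i => 1 + ε * (ε + w * u i)) ≠ 0 := by
  -- nonvanishing on the real axis
  have hreal : ∀ u : Fin N → ℂ, (∀ i, 0 < (u i).im) → ∀ r : ℝ,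
      bih π (fun i => ε + r * u i) (fun i => 1 + ε * (ε + r * u i)) ≠ 0 := by
    intro u hu r
    rcases eq_or_ne r 0 with h0 | h0
    · have := bih_const_ne π hπ (fun _ => 1) (by simp) ε (1 + ε * ε) hε (by positivity)
      simpa [h0] using this
    have him : ∀ i, (ε + r * u i : ℂ).im = r * (u i).im := by intro i; simp
    have hy : ∀ i, (1 + ε * (ε + r * u i) : ℂ) ≠ 0 := by
      intro i h
      have := congrArg Complex.im h
      simp [hε.ne', h0, (hu i).ne'] at this
    rw [bih_eq _ _ _ hy]
    refine mul_ne_zero (Finset.prod_ne_zero_iff.mpr fun i _ => hy i) ?_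
    rcases lt_or_gt_of_ne h0 with h | h
    · apply genPoly_ne_of_neg π hSR
      intro i
      rw [mob_im _ _ (hy i), him]
      exact div_neg_of_neg_of_pos (mul_neg_of_neg_of_pos h (hu i)) (Complex.normSq_pos.mpr (hy i))
    · apply hSR
      intro i
      rw [mob_im _ _ (hy i), him]
      exact div_pos (mul_pos h (hu i)) (Complex.normSq_pos.mpr (hy i))
  -- homogeneity
  have hhom : ∀ (c : ℂ) (x y : Fin N → ℂ), bih π (fun i => c * x i) (fun i => c * y i) =
      c ^ N * bih π x y := by
    intro c x y
    rw [bih, bih, Finset.mul_sum]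
    refine Finset.sum_congr rfl fun S _ => ?_
    rw [Finset.prod_mul_distrib, Finset.prod_mul_distrib, Finset.prod_const, Finset.prod_const]
    have : c ^ N = c ^ S.card * c ^ (Sᶜ).card := by
      rw [← pow_add, Finset.card_add_card_compl, Fintype.card_fin]
    rw [this]; ring
  let U : ℝ → Fin N → ℂ := fun t i => (1 - t) * Complex.I + t * u i
  have hU : ∀ t ∈ Set.Icc (0:ℝ) 1, ∀ i, 0 < (U t i).im := by
    intro t ht i
    have : (U t i).im = (1 - t) + t * (u i).im := by simp [U]
    rw [this]
    rcases eq_or_lt_of_le ht.1 with h | h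
    · rw [← h]; simp
    · have := mul_pos h (hu i); linarith [ht.2]
  let X : ℝ → ℂ → Fin N → ℂ := fun t ξ i =>
    ε * (1 - ξ) + (-Complex.I * (1 + ξ)) * U t i
  let F : ℝ → ℂ → ℂ := fun t ξ => bih π (X t ξ) (fun i => (1 - ξ) + ε * X t ξ i)
  have hscale : ∀ t ξ, ξ ≠ 1 → F t ξ = (1 - ξ) ^ N *
      bih π (fun i => ε + (-Complex.I * (1 + ξ) / (1 - ξ)) * U t i)
        (fun i => 1 + ε * (ε + (-Complex.I * (1 + ξ) / (1 - ξ)) * U t i)) := by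
    intro t ξ hξ
    have h1 : (1 - ξ) ≠ 0 := sub_ne_zero.mpr hξ.symm
    rw [← hhom]
    simp only [F, X]
    congr 1 <;> (funext i; field_simp)
  have hbd : ∀ t ∈ Set.Icc (0:ℝ) 1, ∀ ξ : ℂ, ‖ξ‖ = 1 → F t ξ ≠ 0 := by
    intro t ht ξ hξ
    rcases eq_or_ne ξ 1 with h1 | h1
    · have := bih_const_ne π hπ (fun i => (-Complex.I * 2) * U t i) (fun i => by
        have : U t i ≠ 0 := fun h => by have := hU t ht i; rw [h] at this; simp at this
        simp [this]) 1 ε one_pos hε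
      simp only [F, X, h1]
      convert this using 3 <;> push_cast <;> ring
    · have h1' : (1 - ξ) ≠ 0 := sub_ne_zero.mpr h1.symm
      rw [hscale t ξ h1]
      refine mul_ne_zero (pow_ne_zero _ h1') ?_
      have hr : (-Complex.I * (1 + ξ) / (1 - ξ)) = (((-Complex.I * (1 + ξ) / (1 - ξ)).re : ℝ) : ℂ) := by
        symm
        rw [← Complex.conj_eq_iff_re]
        have hc : (starRingEnd ℂ) ξ = ξ⁻¹ := by
          rw [Complex.inv_def, Complex.normSq_eq_norm_sq, hξ]; simp
        have hξ0 : ξ ≠ 0 := by intro h; rw [h] at hξ; simp at hξ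
        have h2 : ξ - 1 ≠ 0 := sub_ne_zero.mpr h1
        have h3 : 1 - ξ⁻¹ ≠ 0 := by
          rw [sub_ne_zero]; intro h; exact h1 (by rw [← inv_inv ξ, ← h, inv_one])
        simp only [map_div₀, map_mul, map_neg, Complex.conj_I, map_add, map_one, map_sub, hc]
        rw [div_eq_div_iff h3 h1']
        field_simp
        ring
      rw [hr]
      exact hreal _ (hU t ht) _
  have hlow : ∀ ξ : ℂ, ‖ξ‖ < 1 → (-Complex.I * (1 + ξ) / (1 - ξ)).im < 0 := by
    intro ξ hξ
    have h1 : (1 - ξ) ≠ 0 := by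
      rw [sub_ne_zero]; rintro rfl; simp at hξ
    have hp := Complex.normSq_pos.mpr h1
    have hn : Complex.normSq ξ < 1 := by
      rw [Complex.normSq_eq_norm_sq]; nlinarith [norm_nonneg ξ]
    rw [Complex.normSq_apply] at hn
    have : (-Complex.I * (1 + ξ) / (1 - ξ)).im =
        -(1 - (ξ.re * ξ.re + ξ.im * ξ.im)) / Complex.normSq (1 - ξ) := by
      rw [Complex.div_im]; simp; field_simp; ring
    rw [this]
    exact div_neg_of_neg_of_pos (by linarith) hp
  have h0 : ∀ ξ : ℂ, ‖ξ‖ ≤ 1 → F 0 ξ ≠ 0 := by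
    intro ξ hξ
    rcases eq_or_lt_of_le hξ with h | h
    · exact hbd 0 (by simp) ξ h
    have hξ1 : ξ ≠ 1 := by rintro rfl; simp at h
    rw [hscale 0 ξ hξ1]
    refine mul_ne_zero (pow_ne_zero _ (sub_ne_zero.mpr hξ1.symm)) ?_
    set ω := (-Complex.I * (1 + ξ) / (1 - ξ)) with hω
    have hωi : ω.im < 0 := hlow ξ h
    have hU0 : ∀ i, U 0 i = Complex.I := by intro i; simp [U]
    simp only [hU0]
    set x : ℂ := ε + ω * Complex.I with hx
    have hxr : 0 < x.re := by simp [hx]; linarith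
    have hy : (1 + ε * x : ℂ) ≠ 0 := by
      intro h
      have := congrArg Complex.re h
      simp at this
      nlinarith [mul_pos hε hxr]
    rw [bih_eq _ _ _ (fun _ => hy)]
    refine mul_ne_zero (Finset.prod_ne_zero_iff.mpr fun i _ => hy) ?_
    rcases lt_trichotomy x.im 0 with h | h | h
    · apply genPoly_ne_of_neg π hSR
      intro i
      rw [mob_im _ _ hy]
      exact div_neg_of_neg_of_pos h (Complex.normSq_pos.mpr hy)
    · have hxx : x = (x.re : ℂ) := by apply Complex.ext <;> simp [h]
      have := bih_const_ne π hπ (fun _ => 1) (by simp) x.re (1 + ε * x.re) hxr (by positivity)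
      push_cast at this
      rw [← hxx] at this
      simp only [mul_one] at this
      rw [bih_eq _ _ _ (fun _ => hy)] at this
      exact right_ne_zero_of_mul this
    · apply hSR
      intro i
      rw [mob_im _ _ hy]
      exact div_pos h (Complex.normSq_pos.mpr hy)
  have hcont : Continuous fun x : ℝ × ℂ => F x.1 x.2 := by
    simp only [F, X, U, bih]
    fun_prop
  have hdiff : ∀ t, Differentiable ℂ (F t) := by
    intro t
    simp only [F, X, U, bih]
    fun_prop
  -- apply the homotopy at the Cayley preimage of `w`
  have hden : w - Complex.I ≠ 0 := by
    rw [sub_ne_zero]; rintro rfl; simp at hw; linarith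
  set ξ : ℂ := (w + Complex.I) / (w - Complex.I) with hξd
  have hξ : ‖ξ‖ ≤ 1 := by
    rw [hξd, norm_div]
    apply div_le_one_of_le₀ _ (norm_nonneg _)
    rw [← abs_of_nonneg (norm_nonneg (w + Complex.I)), ← abs_of_nonneg (norm_nonneg (w - Complex.I)),
      ← sq_le_sq, ← Complex.normSq_eq_norm_sq, ← Complex.normSq_eq_norm_sq, Complex.normSq_apply,
      Complex.normSq_apply]
    simp
    nlinarith
  have h1ξ : 1 - ξ = -2 * Complex.I / (w - Complex.I) := by
    rw [hξd]; field_simp; ring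
  have hξ1 : ξ ≠ 1 := by
    intro h
    rw [h, sub_self] at h1ξ
    have : -2 * Complex.I / (w - Complex.I) ≠ 0 := div_ne_zero (by simp) hden
    exact this h1ξ.symm
  have hfin := disc_homotopy F hcont hdiff hbd h0 ξ hξ
  rw [hscale 1 ξ hξ1] at hfin
  have hww : (-Complex.I * (1 + ξ) / (1 - ξ)) = w := by
    rw [h1ξ, hξd]
    have hI := Complex.I_ne_zero
    field_simp
    ring
  have hU1 : ∀ i, U 1 i = u i := by intro i; simp [U]
  rw [hww] at hfin
  simp only [hU1] at hfin
  exact right_ne_zero_of_mul hfin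

/-- Real-stability with nonnegative coefficients: zero-freeness in rotated half-planes. -/
lemma rot {N : ℕ} (π : Finset (Fin N) → ℝ) (hπ : IsProbDist π) (hSR : StronglyRayleigh π)
    (z : Fin N → ℂ) (hz : ∀ i, 0 < (z i).im) (w : ℂ) (hw : 0 < w.im) :
    genPoly π (fun i => z i / w) ≠ 0 := by
  have hw0 : w ≠ 0 := by rintro rfl; simp at hw
  have hev : ∀ i, ∀ᶠ ε : ℝ in nhdsWithin 0 (Set.Ioi 0), (1 - ε * (z i / w) ≠ 0 ∧
      0 < (((z i / w) / (1 - ε * (z i / w)) - ε) * w).im) := by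
    intro i
    apply Filter.Eventually.filter_mono nhdsWithin_le_nhds
    have hc0 : Continuous (fun ε : ℝ => (1 - ε * (z i / w) : ℂ)) := by fun_prop
    have hc : ContinuousAt (fun ε : ℝ => (((z i / w) / (1 - ε * (z i / w)) - ε) * w).im) 0 := by
      apply Complex.continuous_im.continuousAt.comp
      apply ContinuousAt.mul _ continuousAt_const
      apply ContinuousAt.sub _ Complex.continuous_ofReal.continuousAt
      exact ContinuousAt.div continuousAt_const hc0.continuousAt (by simp)
    refine Filter.Eventually.and (hc0.continuousAt.eventually_ne (by simp)) ?_
    apply hc.eventually (lt_mem_nhds _)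
    simp only [Complex.ofReal_zero, zero_mul, sub_zero, div_one]
    rw [div_mul_cancel₀ _ hw0]
    exact hz i
  obtain ⟨ε, hall, hε⟩ := ((Filter.eventually_all.mpr hev).and self_mem_nhdsWithin).exists
  have hε : 0 < ε := hε
  have hwi : (w⁻¹).im < 0 := by
    rw [Complex.inv_im]
    exact div_neg_of_neg_of_pos (by linarith) (Complex.normSq_pos.mpr hw0)
  have h := rot_reg π hπ hSR ε hε (fun i => ((z i / w) / (1 - ε * (z i / w)) - ε) * w)
    (fun i => (hall i).2) w⁻¹ hwi
  have hx : ∀ i, (ε + w⁻¹ * (((z i / w) / (1 - ε * (z i / w)) - ε) * w) : ℂ) =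
      (z i / w) / (1 - ε * (z i / w)) := by
    intro i
    rw [mul_comm _ w, inv_mul_cancel_left₀ hw0]; ring
  simp only [hx] at h
  have hy : ∀ i, (1 + ε * ((z i / w) / (1 - ε * (z i / w))) : ℂ) = 1 / (1 - ε * (z i / w)) := by
    intro i
    have := (hall i).1
    generalize z i / w = v at *
    field_simp; ring
  simp only [hy] at h
  rw [bih_eq _ _ _ (fun i => one_div_ne_zero (hall i).1)] at h
  have h := right_ne_zero_of_mul h
  have he : ∀ i, (z i / w) / (1 - ε * (z i / w)) / (1 / (1 - ε * (z i / w))) = z i / w := by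
    intro i
    have := (hall i).1
    generalize z i / w = v at *
    rw [div_div, mul_one_div_cancel this, div_one]
  simpa only [he] using h

/-- `[N] ⊔ [N] ≃ [2N]`. -/
def twoEquiv (N : ℕ) : Fin N ⊕ Fin N ≃ Fin (2 * N) :=
  finSumFinEquiv.trans (finCongr (two_mul N).symm)

/-- The subset of `[2N]` with the given two halves. -/
def joinSet (N : ℕ) (S U : Finset (Fin N)) : Finset (Fin (2 * N)) :=
  (S.disjSum U).map (twoEquiv N).toEmbedding

lemma sum_join {M : Type*} [AddCommMonoid M] (N : ℕ) (F : Finset (Fin (2 * N)) → M) :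
    ∑ T, F T = ∑ S : Finset (Fin N), ∑ U : Finset (Fin N), F (joinSet N S U) := by
  rw [← Fintype.sum_prod_type']
  symm
  apply Fintype.sum_equiv
    ((Finset.sumEquiv (α := Fin N) (β := Fin N)).symm.toEquiv.trans (twoEquiv N).finsetCongr)
  intro x
  rfl

lemma card_join (N : ℕ) (S U : Finset (Fin N)) : (joinSet N S U).card = S.card + U.card := by
  simp [joinSet]

lemma restrict_join (N : ℕ) (S U : Finset (Fin N)) : restrictDown N (joinSet N S U) = S := by
  ext i
  have : Fin.castLE (by omega) i = (twoEquiv N) (Sum.inl i) := by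
    ext; simp [twoEquiv]
  simp only [restrictDown, Finset.mem_filter, Finset.mem_univ, true_and]
  rw [this, joinSet]
  simp

lemma prod_join (N : ℕ) (S U : Finset (Fin N)) (z : Fin (2 * N) → ℂ) :
    ∏ i ∈ joinSet N S U, z i =
      (∏ i ∈ S, z (twoEquiv N (Sum.inl i))) * ∏ i ∈ U, z (twoEquiv N (Sum.inr i)) := by
  rw [joinSet, Finset.prod_map, Finset.prod_disjSum]
  rfl

lemma symmHom_join (N : ℕ) (π : Finset (Fin N) → ℝ) (S U : Finset (Fin N)) :
    symmHom N π (joinSet N S U) =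
      if U ∈ Finset.powersetCard (N - S.card) univ then π S / (N.choose S.card : ℝ) else 0 := by
  have hS : S.card ≤ N := by simpa using Finset.card_le_univ S
  rw [symmHom, restrict_join, card_join]
  congr 1
  simp only [Finset.mem_powersetCard, Finset.subset_univ, true_and, eq_iff_iff]
  omega

/-- Borcea–Brändén–Liggett: closure of strongly Rayleigh distributions
under symmetric homogenization. -/
theorem stronglyRayleigh_symmHom
    (N : ℕ) (π : Finset (Fin N) → ℝ)
    (hπ : IsProbDist π) (hSR : StronglyRayleigh π) :
    IsProbDist (symmHom N π) ∧ StronglyRayleigh (symmHom N π) := by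
  have hS : ∀ S : Finset (Fin N), S.card ≤ N := fun S => by simpa using Finset.card_le_univ S
  refine ⟨⟨fun T => ?_, ?_⟩, fun zz hzz => ?_⟩
  · rw [symmHom]
    split_ifs
    · exact div_nonneg (hπ.1 _) (Nat.cast_nonneg _)
    · exact le_rfl
  · rw [sum_join, ← hπ.2]
    refine Finset.sum_congr rfl fun S _ => ?_
    simp only [symmHom_join]
    rw [Finset.sum_ite_mem, Finset.univ_inter, Finset.sum_const, Finset.card_powersetCard,
      Finset.card_univ, Fintype.card_fin, Nat.choose_symm (hS S), nsmul_eq_mul]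
    have : (N.choose S.card : ℝ) ≠ 0 := by exact_mod_cast (Nat.choose_pos (hS S)).ne'
    field_simp
  · set z : Fin N → ℂ := fun i => zz (twoEquiv N (Sum.inl i)) with hz
    set w : Fin N → ℂ := fun i => zz (twoEquiv N (Sum.inr i)) with hw
    let q : Polynomial ℂ := ∑ S : Finset (Fin N),
      Polynomial.C ((π S : ℂ) * ∏ i ∈ S, z i) * Polynomial.X ^ (N - S.card)
    let s : Multiset ℂ := (univ : Finset (Fin N)).val.map w
    have hs : s.card = N := by simp [s]
    have hq : ∀ x : ℂ, 0 < x.im → q.eval x ≠ 0 := by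
      intro x hx
      have hx0 : x ≠ 0 := by rintro rfl; simp at hx
      have : q.eval x = x ^ N * genPoly π (fun i => z i / x) := by
        simp only [q, Polynomial.eval_finsetSum, genPoly, Finset.mul_sum, Polynomial.eval_mul,
          Polynomial.eval_C, Polynomial.eval_pow, Polynomial.eval_X]
        refine Finset.sum_congr rfl fun S _ => ?_
        have hpow : x ^ N = x ^ (N - S.card) * x ^ S.card := by
          rw [← pow_add, Nat.sub_add_cancel (hS S)]
        rw [Finset.prod_div_distrib, Finset.prod_const, hpow]
        field_simp
      rw [this]
      exact mul_ne_zero (pow_ne_zero _ hx0) (rot π hπ hSR z (fun i => hzz _) x hx)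
    have hd : q.natDegree ≤ s.card := by
      rw [hs]
      refine Polynomial.natDegree_sum_le_of_forall_le _ _ fun S _ => ?_
      exact (Polynomial.natDegree_C_mul_X_pow_le _ _).trans (Nat.sub_le _ _)
    have hmain := gws s q (by
      intro a ha
      obtain ⟨i, _, rfl⟩ := Multiset.mem_map.mp ha
      exact hzz _) hd hq
    have heq : genPoly (symmHom N π) zz = polar q s := by
      rw [genPoly, sum_join, polar, hs]
      simp only [q, Polynomial.finsetSum_coeff, Polynomial.coeff_C_mul, Polynomial.coeff_X_pow,
        Finset.sum_mul, Finset.sum_div]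
      rw [Finset.sum_comm (s := range (N + 1))]
      refine Finset.sum_congr rfl fun S _ => ?_
      rw [Finset.sum_eq_single (N - S.card)]
      · rw [Nat.choose_symm (hS S)]
        simp only [s, Finset.esymm_map_val, if_true]
        simp only [symmHom_join, prod_join, apply_ite Complex.ofReal, Complex.ofReal_zero, ite_mul,
          zero_mul]
        rw [Finset.sum_ite_mem, Finset.univ_inter, ← Finset.mul_sum, ← Finset.mul_sum]
        push_cast
        ring
      · intro k _ hk
        simp [hk]
      · intro h
        exact absurd (Finset.mem_range.mpr (by omega)) h
    rw [heq]
    exact hmain
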